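/- Every connected K_4-minimal graph belongs to at least one of the following categories: (1) it is a subdivision of K_4; (2) it is a wheel, i.e., it consists of an induced cycle plus one additional vertex adjacent to at least 3 vertices of that cycle; (3) it consists of two vertex-disjoint triangles x_1x_2x_3 and y_1y_2y_3 together with three pairwise vertex-disjoint paths P_1, P_2, P_3, where P_i joins x_i to y_i, each path is internally disjoint from both triangles, and every vertex lies on a triangle or a path; (4) it is isomorphic to the complete bipartite graph K_{3,3}; (5) it has at most five vertices of degree at least 3. -/

import Mathlib

open SimpleGraph

variable {α β : Type*}

/-- A model of `H` in `G`: a family of pairwise disjoint nonempty vertex subsets of `G`,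
each inducing a connected subgraph, such that for every edge `h h'` of `H` there is an
edge of `G` between `V h` and `V h'`. -/
def IsMinorModel (G : SimpleGraph α) (H : SimpleGraph β) (V : β → Set α) : Prop :=
  (∀ h, (V h).Nonempty) ∧
  (Pairwise fun h h' => Disjoint (V h) (V h')) ∧
  (∀ h, (G.induce (V h)).Connected) ∧
  ∀ h h', H.Adj h h' → ∃ x ∈ V h, ∃ y ∈ V h', G.Adj x y

/-- `H` is a minor of `G`. -/
def HasMinor (G : SimpleGraph α) (H : SimpleGraph β) : Prop :=
  ∃ V : β → Set α, IsMinorModel G H V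

/-- `G` is `H`-minimal: `H` is a minor of `G`, but for every vertex `x` of `G`,
`H` is not a minor of `G − x`. -/
def MinorMinimal (G : SimpleGraph α) (H : SimpleGraph β) : Prop :=
  HasMinor G H ∧ ∀ x : α, ¬ HasMinor (G.induce {y | y ≠ x}) H

/-- A graph is 2-connected if it has at least 3 vertices, is connected, and stays
connected after deleting any single vertex. -/
def TwoConnected [Fintype α] (G : SimpleGraph α) : Prop :=
  3 ≤ Fintype.card α ∧ G.Connected ∧ ∀ v : α, (G.induce {w | w ≠ v}).Connected

/-- `G` is a cycle: connected and 2-regular. -/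
def IsCycleGraph (G : SimpleGraph α) : Prop :=
  G.Connected ∧ ∀ v : α, (G.neighborSet v).ncard = 2
/-- `G` is a subdivision of `H`: `G` is obtained from `H` by replacing each edge by a
path between (the images of) its endpoints, these paths being internally disjoint from
each other and from the (images of the) vertices of `H`. -/
def IsSubdivision (G : SimpleGraph α) (H : SimpleGraph β) : Prop :=
  ∃ v : β → α, Function.Injective v ∧
    ∃ P : ∀ ⦃a b : β⦄, H.Adj a b → G.Walk (v a) (v b),
      (∀ a b (h : H.Adj a b), (P h).IsPath) ∧
      (∀ a b (h : H.Adj a b), P h.symm = (P h).reverse) ∧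
      (∀ a b (h : H.Adj a b) a' b' (h' : H.Adj a' b'), s(a, b) ≠ s(a', b') →
        ∀ x, x ∈ (P h).support → x ∈ (P h').support → x = v a ∨ x = v b) ∧
      (∀ a b (h : H.Adj a b) (c : β), v c ∈ (P h).support → c = a ∨ c = b) ∧
      (∀ x : α, (∃ c, x = v c) ∨ ∃ (a b : β) (h : H.Adj a b), x ∈ (P h).support) ∧
      (∀ x y : α, G.Adj x y ↔ ∃ (a b : β) (h : H.Adj a b), s(x, y) ∈ (P h).edges)

/-- `G` is a wheel: an induced cycle plus one additional vertex adjacent to at least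
3 vertices of the cycle. -/
def IsWheel (G : SimpleGraph α) : Prop :=
  ∃ w : α, ((G.induce {u | u ≠ w}).Connected ∧
      ∀ u : {u : α // u ≠ w}, ((G.induce {u | u ≠ w}).neighborSet u).ncard = 2) ∧
    3 ≤ (G.neighborSet w).ncard
/-- `G` consists of two vertex-disjoint triangles `x 0, x 1, x 2` and `y 0, y 1, y 2`
together with three pairwise vertex-disjoint paths, the `i`-th joining `x i` to `y i`,
each internally disjoint from both triangles, every vertex of `G` lying on one of the
triangles or paths, and every edge of `G` being a triangle edge or a path edge. -/
def TwoTrianglesThreePaths (G : SimpleGraph α) : Prop :=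
  ∃ x y : Fin 3 → α,
    (∀ i j, i ≠ j → G.Adj (x i) (x j)) ∧
    (∀ i j, i ≠ j → G.Adj (y i) (y j)) ∧
    (∀ i j, x i ≠ y j) ∧
    ∃ P : (i : Fin 3) → G.Walk (x i) (y i),
      (∀ i, (P i).IsPath) ∧
      (∀ i j, i ≠ j → ∀ z, z ∈ (P i).support → z ∉ (P j).support) ∧
      (∀ i j z, z ∈ (P i).support → (z = x j ∨ z = y j) → (z = x i ∨ z = y i)) ∧
      (∀ z : α, ∃ i, z ∈ (P i).support) ∧
      (∀ z w, G.Adj z w →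
        (∃ i j, i ≠ j ∧ ((z = x i ∧ w = x j) ∨ (z = y i ∧ w = y j))) ∨
        ∃ i, s(z, w) ∈ (P i).edges)

section

variable {G : SimpleGraph α} {A B C D : Set α}

/-- The set `A` induces a connected subgraph. -/
def ConnSet (G : SimpleGraph α) (A : Set α) : Prop := (G.induce A).Connected

/-- There is an edge between `A` and `B`. -/
def Touch (G : SimpleGraph α) (A B : Set α) : Prop := ∃ a ∈ A, ∃ b ∈ B, G.Adj a b

theorem Touch.symm (h : Touch G A B) : Touch G B A := by
  obtain ⟨a, ha, b, hb, hab⟩ := h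
  exact ⟨b, hb, a, ha, hab.symm⟩

theorem touch_comm : Touch G A B ↔ Touch G B A := ⟨Touch.symm, Touch.symm⟩

theorem touch_union_left : Touch G (A ∪ B) C ↔ Touch G A C ∨ Touch G B C := by
  simp only [Touch, Set.mem_union]; grind

theorem touch_union_right : Touch G C (A ∪ B) ↔ Touch G C A ∨ Touch G C B := by
  simp only [Touch, Set.mem_union]; grind

theorem Touch.mono {A' B' : Set α} (h : Touch G A B) (hA : A ⊆ A') (hB : B ⊆ B') :
    Touch G A' B' := by
  obtain ⟨a, ha, b, hb, hab⟩ := h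
  exact ⟨a, hA ha, b, hB hb, hab⟩

theorem ConnSet.nonempty (h : ConnSet G A) : A.Nonempty :=
  Set.nonempty_coe_sort.1 (Connected.nonempty h)

theorem connSet_singleton (G : SimpleGraph α) (a : α) : ConnSet G {a} := by
  have : Nonempty ({a} : Set α) := ⟨⟨a, rfl⟩⟩
  exact ⟨Preconnected.of_subsingleton⟩

theorem ConnSet.union (hA : ConnSet G A) (hB : ConnSet G B) (h : Touch G A B) :
    ConnSet G (A ∪ B) := by
  obtain ⟨a, ha, b, hb, hab⟩ := h
  have h₁ : ConnSet G (A ∪ {a, b}) :=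
    induce_union_connected hA.preconnected (induce_pair_connected_of_adj hab).preconnected
      ⟨a, ha, by simp⟩
  have h₂ : ConnSet G (A ∪ {a, b} ∪ B) :=
    induce_union_connected h₁.preconnected hB.preconnected ⟨b, by simp, hb⟩
  have : A ∪ {a, b} ∪ B = A ∪ B := by grind
  rwa [this] at h₂

/-- A proper nonempty subset of a connected set has an edge leaving it. -/
theorem ConnSet.touch_diff {S : Set α} (hA : ConnSet G A) (hSA : S ⊆ A) (hS : S.Nonempty)
    (hne : S ≠ A) : Touch G S (A \ S) := by
  obtain ⟨s, hs⟩ := hS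
  obtain ⟨t, htA, htS⟩ : ∃ t ∈ A, t ∉ S := by
    by_contra! h
    exact hne (hSA.antisymm h)
  obtain ⟨p⟩ := hA.preconnected ⟨s, hSA hs⟩ ⟨t, htA⟩
  obtain ⟨d, -, hd₁, hd₂⟩ := p.exists_boundary_dart {u | u.1 ∈ S} hs htS
  exact ⟨d.fst, hd₁, d.snd, ⟨d.snd.2, hd₂⟩, d.adj⟩

theorem ConnSet.touch_of_union_eq {S T : Set α} (hA : ConnSet G A) (h : S ∪ T = A)
    (hd : Disjoint S T) (hS : S.Nonempty) (hT : T.Nonempty) : Touch G S T := by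
  have hT' : A \ S = T := by rw [← h, Set.union_sdiff_left, hd.symm.sdiff_eq_left]
  rw [← hT']
  refine hA.touch_diff (h ▸ Set.subset_union_left) hS ?_
  rintro rfl
  simp [← hT'] at hT

/-- A connected set can lose one vertex, other than a prescribed one, and stay connected. -/
theorem ConnSet.exists_ne_diff [Finite α] {a b : α} (hA : ConnSet G A) (ha : a ∈ A) (hb : b ∈ A)
    (hab : b ≠ a) : ∃ x ∈ A, x ≠ a ∧ ConnSet G (A \ {x}) := by
  obtain ⟨S, hS⟩ := (Set.toFinite {S : Set α | ConnSet G S ∧ a ∈ S ∧ S ⊂ A}).exists_maximal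
    ⟨{a}, connSet_singleton G a, rfl, by simpa using ha, fun h ↦ hab (h hb)⟩
  obtain ⟨⟨hSc, haS, hSA⟩, hmax⟩ := hS
  obtain ⟨s, hs, y, ⟨hyA, hyS⟩, hsy⟩ := hA.touch_diff hSA.1 ⟨a, haS⟩ hSA.ne
  have hc : ConnSet G (S ∪ {y}) := hSc.union (connSet_singleton G y) ⟨s, hs, y, rfl, hsy⟩
  have hEq : S ∪ {y} = A := by
    by_contra hne
    have hsub : S ∪ {y} ⊆ A := Set.union_subset hSA.1 (by simpa using hyA)
    exact hyS (hmax ⟨hc, Or.inl haS, hsub.ssubset_of_ne hne⟩ Set.subset_union_left (Or.inr rfl))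
  refine ⟨y, hyA, fun h ↦ hyS (h ▸ haS), ?_⟩
  have : A \ {y} = S := by rw [← hEq]; grind
  rwa [this]

/-- A connected set with at least two vertices has two non-cut vertices. -/
theorem ConnSet.exists_two_diff [Finite α] (hA : ConnSet G A) (h : A.Nontrivial) :
    ∃ x ∈ A, ∃ y ∈ A, x ≠ y ∧ ConnSet G (A \ {x}) ∧ ConnSet G (A \ {y}) := by
  obtain ⟨a, ha, b, hb, hab⟩ := h
  obtain ⟨x, hx, hxa, hxc⟩ := hA.exists_ne_diff ha hb hab.symm
  obtain ⟨y, hy, hyx, hyc⟩ := hA.exists_ne_diff hx ha hxa.symm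
  exact ⟨x, hx, y, hy, hyx.symm, hxc, hyc⟩

/-- Two vertices of a connected set can be separated by a partition into two connected sets. -/
theorem ConnSet.exists_split [Finite α] {p q : α} (hA : ConnSet G A) (hp : p ∈ A) (hq : q ∈ A)
    (hpq : p ≠ q) : ∃ P Q : Set α, ConnSet G P ∧ ConnSet G Q ∧ p ∈ P ∧ q ∈ Q ∧ Disjoint P Q ∧
      P ∪ Q = A := by
  obtain ⟨⟨P, Q⟩, hmem, hmax⟩ := (Set.toFinite {S : Set α × Set α | ConnSet G S.1 ∧ ConnSet G S.2 ∧
      p ∈ S.1 ∧ q ∈ S.2 ∧ Disjoint S.1 S.2 ∧ S.1 ∪ S.2 ⊆ A}).exists_maximal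
    ⟨({p}, {q}), connSet_singleton G p, connSet_singleton G q, rfl, rfl, by simpa using hpq,
      by simp [Set.insert_subset_iff, hp, hq]⟩
  obtain ⟨hP, hQ, hpP, hqQ, hd, hsub⟩ := hmem
  refine ⟨P, Q, hP, hQ, hpP, hqQ, hd, ?_⟩
  by_contra hne
  obtain ⟨s, hs, y, ⟨hyA, hyS⟩, hsy⟩ := hA.touch_diff hsub ⟨p, Or.inl hpP⟩ hne
  have hy := connSet_singleton G y
  simp only [Set.mem_union, not_or] at hyS
  rcases hs with hs | hs
  · have := hmax (y := (P ∪ {y}, Q)) ⟨hP.union hy ⟨s, hs, y, rfl, hsy⟩, hQ, Or.inl hpP, hqQ,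
      by simp [hd, hyS.2], by simpa [Set.union_subset_iff, Set.insert_subset_iff, hyA] using hsub⟩
      ⟨Set.subset_union_left, le_rfl⟩
    exact hyS.1 (this.1 (Or.inr rfl))
  · have := hmax (y := (P, Q ∪ {y})) ⟨hP, hQ.union hy ⟨s, hs, y, rfl, hsy⟩, hpP, Or.inl hqQ,
      by simp [hd, hyS.1], by simpa [Set.union_subset_iff, Set.insert_subset_iff, hyA] using hsub⟩
      ⟨le_rfl, Set.subset_union_left⟩
    exact hyS.2 (this.2 (Or.inr rfl))

/-- The four sets are the branch sets of a model of `K₄`. -/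
structure K4Model (G : SimpleGraph α) (A B C D : Set α) : Prop where
  conn : ConnSet G A ∧ ConnSet G B ∧ ConnSet G C ∧ ConnSet G D
  disj : Disjoint A B ∧ Disjoint A C ∧ Disjoint A D ∧ Disjoint B C ∧ Disjoint B D ∧ Disjoint C D
  touch : Touch G A B ∧ Touch G A C ∧ Touch G A D ∧ Touch G B C ∧ Touch G B D ∧ Touch G C D

/-- Every model of `K₄` uses all vertices. -/
def K4Spanning (G : SimpleGraph α) : Prop :=
  ∀ A B C D, K4Model G A B C D → ∀ x, x ∈ A ∨ x ∈ B ∨ x ∈ C ∨ x ∈ D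

theorem connSet_preimage {s : Set α} (hA : ConnSet G A) (hs : A ⊆ s) :
    ConnSet (G.induce s) (Subtype.val ⁻¹' A : Set s) :=
  hA.map (f := (⟨fun a ↦ ⟨⟨a.1, hs a.2⟩, a.2⟩, fun h ↦ h⟩ :
    G.induce A →g (G.induce s).induce (Subtype.val ⁻¹' A))) (fun a ↦ ⟨⟨a.1.1, a.2⟩, rfl⟩)

theorem MinorMinimal.k4Spanning (h : MinorMinimal G (⊤ : SimpleGraph (Fin 4))) :
    K4Spanning G := by
  intro A B C D hM x
  by_contra! hx
  obtain ⟨hc, hd, ht⟩ := hM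
  have hsub : ∀ i, (![A, B, C, D] i) ⊆ {y | y ≠ x} := by
    intro i y hy
    rintro rfl
    fin_cases i <;> simp_all
  have hconn : ∀ i, ConnSet G (![A, B, C, D] i) := by
    intro i; fin_cases i <;> simp [hc]
  refine h.2 x ⟨fun i ↦ Subtype.val ⁻¹' (![A, B, C, D] i), ?_, ?_, ?_, ?_⟩
  · intro i
    obtain ⟨y, hy⟩ := (hconn i).nonempty
    exact ⟨⟨y, hsub i hy⟩, hy⟩
  · intro i j hij
    refine Disjoint.preimage _ ?_
    fin_cases i <;> fin_cases j <;> simp_all [disjoint_comm]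
  · exact fun i ↦ connSet_preimage (hconn i) (hsub i)
  · intro i j hij
    have : Touch G (![A, B, C, D] i) (![A, B, C, D] j) := by
      fin_cases i <;> fin_cases j <;> simp_all [touch_comm]
    obtain ⟨a, ha, b, hb, hab⟩ := this
    exact ⟨⟨a, hsub i ha⟩, ha, ⟨b, hsub j hb⟩, hb, hab⟩

theorem MinorMinimal.exists_k4Model (h : MinorMinimal G (⊤ : SimpleGraph (Fin 4))) :
    ∃ A B C D, K4Model G A B C D := by
  obtain ⟨V, -, hd, hc, ht⟩ := h.1
  have ht' : ∀ i j, i ≠ j → Touch G (V i) (V j) := fun i j hij ↦ ht i j hij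
  exact ⟨V 0, V 1, V 2, V 3, ⟨hc 0, hc 1, hc 2, hc 3⟩,
    ⟨hd (by decide), hd (by decide), hd (by decide), hd (by decide), hd (by decide),
      hd (by decide)⟩,
    ⟨ht' _ _ (by decide), ht' _ _ (by decide), ht' _ _ (by decide), ht' _ _ (by decide),
      ht' _ _ (by decide), ht' _ _ (by decide)⟩⟩

/-- The five sets are the hub and, in cyclic order, the rim branch sets of a model of the wheel
with four spokes. -/
structure W4Model (G : SimpleGraph α) (H A B C D : Set α) : Prop where
  conn : ConnSet G H ∧ ConnSet G A ∧ ConnSet G B ∧ ConnSet G C ∧ ConnSet G D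
  disj : Disjoint H A ∧ Disjoint H B ∧ Disjoint H C ∧ Disjoint H D ∧ Disjoint A B ∧
    Disjoint A C ∧ Disjoint A D ∧ Disjoint B C ∧ Disjoint B D ∧ Disjoint C D
  hub : Touch G H A ∧ Touch G H B ∧ Touch G H C ∧ Touch G H D
  rim : Touch G A B ∧ Touch G B C ∧ Touch G C D ∧ Touch G D A

/-- If two adjacent parts of a branch set of `K₄` have a common neighbour branch set and each of
them has one more, then there is a model of the wheel with four spokes. -/
theorem K4Model.w4Model_of_split {P Q : Set α} (h : K4Model G (P ∪ Q) B C D)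
    (hP : ConnSet G P) (hQ : ConnSet G Q) (hPQ : Touch G P Q) (hd : Disjoint P Q)
    (h₁ : Touch G P B) (h₂ : Touch G P C) (h₃ : Touch G Q C) (h₄ : Touch G Q D) :
    W4Model G C P Q D B := by
  obtain ⟨hc, hdisj, ht⟩ := h
  refine ⟨by grind, ?_, ?_, ?_⟩
  · simp only [Set.disjoint_left] at *
    grind
  · grind [Touch.symm]
  · grind [Touch.symm]

theorem K4Model.rotate (h : K4Model G A B C D) : K4Model G A C D B := by
  obtain ⟨hc, hd, ht⟩ := h
  exact ⟨by grind, by grind [Disjoint.symm], by grind [Touch.symm]⟩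

theorem K4Model.swap_last (h : K4Model G A B C D) : K4Model G A B D C := by
  obtain ⟨hc, hd, ht⟩ := h
  exact ⟨by grind, by grind [Disjoint.symm], by grind [Touch.symm]⟩

theorem K4Model.swap_first (h : K4Model G A B C D) : K4Model G B A C D := by
  obtain ⟨hc, hd, ht⟩ := h
  exact ⟨by grind, by grind [Disjoint.symm], by grind [Touch.symm]⟩

/-- A vertex between two connected sets `P` and `Q` that both touch the ends of an edge `C D`
has at most one neighbour in `P`. -/
theorem K4Spanning.neighbor_unique [Finite α] (hsp : K4Spanning G)
    (hw : ∀ H A B C D, ¬ W4Model G H A B C D) {P Q : Set α} {x : α}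
    (hc : ConnSet G P ∧ ConnSet G Q ∧ ConnSet G C ∧ ConnSet G D)
    (hd : Disjoint P Q ∧ Disjoint P C ∧ Disjoint P D ∧ Disjoint Q C ∧ Disjoint Q D ∧ Disjoint C D)
    (hx : x ∉ P ∧ x ∉ Q ∧ x ∉ C ∧ x ∉ D) (hxQ : Touch G {x} Q)
    (ht : Touch G P C ∧ Touch G P D ∧ Touch G Q C ∧ Touch G Q D ∧ Touch G C D)
    {p q : α} (hp : p ∈ P) (hq : q ∈ P) (hxp : G.Adj x p) (hxq : G.Adj x q) : p = q := by
  by_contra hpq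
  obtain ⟨R, S, hR, hS, hpR, hqS, hRS, rfl⟩ := hc.1.exists_split hp hq hpq
  have tRS : Touch G R S := hc.1.touch_of_union_eq rfl hRS ⟨p, hpR⟩ ⟨q, hqS⟩
  have txR : Touch G {x} R := ⟨x, rfl, p, hpR, hxp⟩
  have txS : Touch G {x} S := ⟨x, rfl, q, hqS, hxq⟩
  have hxc := connSet_singleton G x
  simp only [touch_union_left] at ht
  have key : ∀ T U : Set α, R ∪ S = T ∪ U → Disjoint T U → ConnSet G T → ConnSet G U →
      Touch G {x} T → Touch G {x} U → Touch G U C → Touch G U D → T.Nonempty → False := by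
    intro T U hTU hdTU hT hU txT txU h₁ h₂ hne
    rw [hTU] at hd hx
    obtain ⟨t, ht'⟩ := hne
    have : K4Model G ({x} ∪ U) Q C D := by
      refine ⟨⟨hxc.union hU txU, hc.2⟩, ?_, ?_⟩
      · simp only [Set.disjoint_left] at *
        grind
      · simp only [touch_union_left]
        grind
    have := hsp _ _ _ _ this t
    simp only [Set.disjoint_left] at *
    grind
  have key' : ∀ C D : Set α, ConnSet G C → ConnSet G D →
      Disjoint (R ∪ S) C ∧ Disjoint (R ∪ S) D ∧ Disjoint Q C ∧ Disjoint Q D ∧ Disjoint C D →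
      x ∉ C → x ∉ D → Touch G Q C → Touch G Q D → Touch G C D → Touch G R C → Touch G S D →
      False := by
    intro C D hC hD hdd hxC hxD tQC tQD tCD tRC tSD
    refine hw ({x} ∪ Q) R S D C ⟨⟨hxc.union hc.2.1 hxQ, hR, hS, hD, hC⟩, ?_, ?_, ?_⟩
    · simp only [Set.disjoint_left] at *
      grind
    · simp only [touch_union_left]
      grind
    · grind [Touch.symm]
  have h₁ := key R S rfl hRS hR hS txR txS
  have h₂ := key S R (Set.union_comm _ _) hRS.symm hS hR txS txR
  have h₃ := key' C D hc.2.2.1 hc.2.2.2 (by grind) hx.2.2.1 hx.2.2.2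
  have h₄ := key' D C hc.2.2.2 hc.2.2.1 (by grind [Disjoint.symm]) hx.2.2.2 hx.2.2.1
  have hRn := hR.nonempty
  have hSn := hS.nonempty
  grind [Touch.symm]

theorem ncard_neighborSet_le_two [Finite α] {x : α} {P Q : Set α}
    (h : ∀ y, G.Adj x y → y ∈ P ∪ Q)
    (hP : ∀ p ∈ P, ∀ q ∈ P, G.Adj x p → G.Adj x q → p = q)
    (hQ : ∀ p ∈ Q, ∀ q ∈ Q, G.Adj x p → G.Adj x q → p = q) : (G.neighborSet x).ncard ≤ 2 := by
  have : G.neighborSet x = (G.neighborSet x ∩ P) ∪ (G.neighborSet x ∩ Q) := by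
    ext y
    have := h y
    simp only [mem_neighborSet, Set.mem_union, Set.mem_inter_iff] at *
    grind
  rw [this]
  refine (Set.ncard_union_le _ _).trans (Nat.add_le_add (b := 1) (d := 1) ?_ ?_)
  · exact (Set.ncard_le_one (Set.toFinite _)).2 fun a ha b hb ↦ hP a ha.2 b hb.2 ha.1 hb.1
  · exact (Set.ncard_le_one (Set.toFinite _)).2 fun a ha b hb ↦ hQ a ha.2 b hb.2 ha.1 hb.1

/-- Moving to a neighbour branch set a non-cut vertex `x` whose only neighbour branch set is this
one preserves a model of `K₄`, and `x` has degree at most two. -/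
theorem K4Spanning.move [Finite α] (hsp : K4Spanning G)
    (hw : ∀ H A B C D, ¬ W4Model G H A B C D) (h : K4Model G A B C D) {x : α} (hx : x ∈ A)
    (hA : ConnSet G (A \ {x})) (hB : Touch G {x} B) (hC : ¬ Touch G {x} C)
    (hD : ¬ Touch G {x} D) :
    K4Model G (A \ {x}) ({x} ∪ B) C D ∧ (G.neighborSet x).ncard ≤ 2 := by
  have hU : A = {x} ∪ (A \ {x}) := by grind
  have hs := hsp _ _ _ _ h
  obtain ⟨hc, hd, ht⟩ := h
  have hxc := connSet_singleton G x
  have txA : Touch G {x} (A \ {x}) :=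
    hc.1.touch_of_union_eq hU.symm Set.disjoint_sdiff_right ⟨x, rfl⟩ hA.nonempty
  have hxA : x ∉ A \ {x} := by simp
  generalize A \ {x} = A' at *
  subst hU
  simp only [touch_union_left] at ht
  have hd' : Disjoint A' B ∧ Disjoint A' C ∧ Disjoint A' D ∧ Disjoint B C ∧ Disjoint B D ∧
      Disjoint C D := by
    simp only [Set.disjoint_left] at *
    grind
  have hx' : x ∉ A' ∧ x ∉ B ∧ x ∉ C ∧ x ∉ D := by
    simp only [Set.disjoint_left] at *
    grind
  refine ⟨⟨⟨hA, hxc.union hc.2.1 hB, hc.2.2⟩, ?_, ?_⟩, ?_⟩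
  · simp only [Set.disjoint_left] at *
    grind
  · simp only [touch_union_left, touch_union_right]
    grind [Touch.symm]
  · refine ncard_neighborSet_le_two (P := A') (Q := B) ?_ ?_ ?_
    · intro y hy
      have h₁ : y ∉ C := fun h ↦ hC ⟨x, rfl, y, h, hy⟩
      have h₂ : y ∉ D := fun h ↦ hD ⟨x, rfl, y, h, hy⟩
      have h₃ := hy.ne'
      have := hs y
      simp only [Set.mem_union, Set.mem_singleton_iff] at *
      grind
    · intro p hp q hq hxp hxq
      exact hsp.neighbor_unique hw ⟨hA, hc.2⟩ hd' hx' hB (by grind) hp hq hxp hxq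
    · intro p hp q hq hxp hxq
      exact hsp.neighbor_unique hw ⟨hc.2.1, hA, hc.2.2⟩ (by grind [Disjoint.symm]) (by grind) txA
        (by grind) hp hq hxp hxq

/-- Without a model of the wheel with four spokes, a branch set of `K₄` that is not a singleton
has a non-cut vertex with only one neighbour branch set. -/
theorem K4Spanning.exists_movable [Finite α] (hsp : K4Spanning G)
    (hw : ∀ H A B C D, ¬ W4Model G H A B C D) (h : K4Model G A B C D) (hA : A.Nontrivial) :
    ∃ x ∈ A, ConnSet G (A \ {x}) ∧
      ((Touch G {x} B ∧ ¬ Touch G {x} C ∧ ¬ Touch G {x} D) ∨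
       (Touch G {x} C ∧ ¬ Touch G {x} D ∧ ¬ Touch G {x} B) ∨
       (Touch G {x} D ∧ ¬ Touch G {x} B ∧ ¬ Touch G {x} C)) := by
  obtain ⟨x, hx, y, hy, hxy, hAx, hAy⟩ := h.conn.1.exists_two_diff hA
  have facts : ∀ x ∈ A, ConnSet G (A \ {x}) →
      (Touch G A B ↔ Touch G {x} B ∨ Touch G (A \ {x}) B) ∧
      (Touch G A C ↔ Touch G {x} C ∨ Touch G (A \ {x}) C) ∧
      (Touch G A D ↔ Touch G {x} D ∨ Touch G (A \ {x}) D) ∧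
      (Touch G {x} B ∨ Touch G {x} C ∨ Touch G {x} D) ∧
      ∀ B' C' D', K4Model G A B' C' D' →
        Touch G {x} B' → Touch G {x} C' → Touch G (A \ {x}) C' → Touch G (A \ {x}) D' → False := by
    intro x hx hAx
    have hU : {x} ∪ (A \ {x}) = A := by grind
    have hB : ∀ B, Touch G A B ↔ Touch G {x} B ∨ Touch G (A \ {x}) B := by
      intro B
      rw [← touch_union_left, hU]
    refine ⟨hB B, hB C, hB D, ?_, ?_⟩
    · by_contra! hno
      have hM : K4Model G (A \ {x}) B C D := by
        obtain ⟨hc, hd, ht⟩ := h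
        refine ⟨⟨hAx, hc.2⟩, ?_, by grind⟩
        exact ⟨hd.1.mono_left Set.sdiff_subset, hd.2.1.mono_left Set.sdiff_subset,
          hd.2.2.1.mono_left Set.sdiff_subset, hd.2.2.2⟩
      have := hsp _ _ _ _ hM x
      have hd := h.disj
      simp only [Set.disjoint_left] at *
      grind
    · intro B' C' D' h' h₁ h₂ h₃ h₄
      rw [← hU] at h'
      refine hw _ _ _ _ _ (h'.w4Model_of_split (connSet_singleton G x) hAx ?_
        Set.disjoint_sdiff_right h₁ h₂ h₃ h₄)
      exact h.conn.1.touch_of_union_eq hU Set.disjoint_sdiff_right ⟨x, rfl⟩ hAx.nonempty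
  have hyx : ∀ B, Touch G {y} B → Touch G (A \ {x}) B := fun B h ↦
    h.mono (by simp [hy, hxy.symm]) le_rfl
  have hxy' : ∀ B, Touch G {x} B → Touch G (A \ {y}) B := fun B h ↦
    h.mono (by simp [hx, hxy]) le_rfl
  obtain ⟨b₁, c₁, d₁, e₁, f₁⟩ := facts x hx hAx
  have hyB := hyx B
  have hyC := hyx C
  have hyD := hyx D
  have g₁ := f₁ _ _ _ h
  have g₂ := f₁ _ _ _ h.rotate
  have g₃ := f₁ _ _ _ h.rotate.rotate
  have g₄ := f₁ _ _ _ h.swap_last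
  have g₅ := f₁ _ _ _ h.rotate.swap_last
  have g₆ := f₁ _ _ _ h.rotate.rotate.swap_last
  have e₂ := (facts y hy hAy).2.2.2.1
  have ht := h.touch
  clear facts f₁ hyx hxy'
  by_cases hX : (Touch G {x} B ∧ ¬ Touch G {x} C ∧ ¬ Touch G {x} D) ∨
       (Touch G {x} C ∧ ¬ Touch G {x} D ∧ ¬ Touch G {x} B) ∨
       (Touch G {x} D ∧ ¬ Touch G {x} B ∧ ¬ Touch G {x} C)
  · exact ⟨x, hx, hAx, hX⟩
  · exact ⟨y, hy, hAy, by grind⟩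

theorem K4Spanning.branch_unique [Finite α] (hsp : K4Spanning G)
    (hw : ∀ H A B C D, ¬ W4Model G H A B C D) (h : K4Model G A B C D) {a b : α} (ha : a ∈ A)
    (hb : b ∈ A) (hda : 3 ≤ (G.neighborSet a).ncard) (hdb : 3 ≤ (G.neighborSet b).ncard) :
    a = b := by
  induction hn : A.ncard using Nat.strong_induction_on generalizing A B C D with
  | _ n ih =>
  by_contra hab
  obtain ⟨x, hx, hAx, hX⟩ := hsp.exists_movable hw h ⟨a, ha, b, hb, hab⟩
  have : ∃ B' C' D', K4Model G (A \ {x}) B' C' D' ∧ (G.neighborSet x).ncard ≤ 2 := by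
    rcases hX with ⟨h₁, h₂, h₃⟩ | ⟨h₁, h₂, h₃⟩ | ⟨h₁, h₂, h₃⟩
    · exact ⟨_, _, _, hsp.move hw h hx hAx h₁ h₂ h₃⟩
    · exact ⟨_, _, _, hsp.move hw h.rotate hx hAx h₁ h₂ h₃⟩
    · exact ⟨_, _, _, hsp.move hw h.rotate.rotate hx hAx h₁ h₂ h₃⟩
  obtain ⟨B', C', D', hM, hdx⟩ := this
  have hax : a ≠ x := by rintro rfl; omega
  have hbx : b ≠ x := by rintro rfl; omega
  exact hab (ih _ (hn ▸ Set.ncard_sdiff_singleton_lt_of_mem hx) hM ⟨ha, hax⟩ ⟨hb, hbx⟩ rfl)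

theorem K4Spanning.ncard_branch_le [Finite α] (hsp : K4Spanning G)
    (hw : ∀ H A B C D, ¬ W4Model G H A B C D) (h : K4Model G A B C D) :
    {u : α | 3 ≤ (G.neighborSet u).ncard}.ncard ≤ 4 := by
  set S := {u : α | 3 ≤ (G.neighborSet u).ncard}
  have hle : ∀ A B C D, K4Model G A B C D → (S ∩ A).ncard ≤ 1 := fun A B C D h ↦
    (Set.ncard_le_one (Set.toFinite _)).2 fun a ha b hb ↦
      hsp.branch_unique hw h ha.2 hb.2 ha.1 hb.1
  have hS : S = (S ∩ A) ∪ (S ∩ B) ∪ (S ∩ C) ∪ (S ∩ D) := by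
    ext u
    have := hsp _ _ _ _ h u
    simp only [Set.mem_union, Set.mem_inter_iff]
    grind
  have h₁ := hle _ _ _ _ h
  have h₂ := hle _ _ _ _ h.swap_first
  have h₃ := hle _ _ _ _ h.rotate.swap_first
  have h₄ := hle _ _ _ _ h.rotate.rotate.swap_first
  rw [hS]
  have := Set.ncard_union_le (S ∩ A ∪ S ∩ B ∪ S ∩ C) (S ∩ D)
  have := Set.ncard_union_le (S ∩ A ∪ S ∩ B) (S ∩ C)
  have := Set.ncard_union_le (S ∩ A) (S ∩ B)
  omega

/-- The sets `X i` and `Y i` are the branch sets of a model of the prism: two triangles joined by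
a perfect matching. -/
structure PrismModel (G : SimpleGraph α) (X Y : Fin 3 → Set α) : Prop where
  connX : ∀ i, ConnSet G (X i)
  connY : ∀ i, ConnSet G (Y i)
  disjX : ∀ i j, i ≠ j → Disjoint (X i) (X j)
  disjY : ∀ i j, i ≠ j → Disjoint (Y i) (Y j)
  disjXY : ∀ i j, Disjoint (X i) (Y j)
  touchX : ∀ i j, i ≠ j → Touch G (X i) (X j)
  touchY : ∀ i j, i ≠ j → Touch G (Y i) (Y j)
  rung : ∀ i, Touch G (X i) (Y i)

/-- The sets `X i` and `Y i` are the branch sets of a model of `K₃,₃`. -/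
structure K33Model (G : SimpleGraph α) (X Y : Fin 3 → Set α) : Prop where
  connX : ∀ i, ConnSet G (X i)
  connY : ∀ i, ConnSet G (Y i)
  disjX : ∀ i j, i ≠ j → Disjoint (X i) (X j)
  disjY : ∀ i j, i ≠ j → Disjoint (Y i) (Y j)
  disjXY : ∀ i j, Disjoint (X i) (Y j)
  touch : ∀ i j, Touch G (X i) (Y j)

theorem prismModel_of_sets {A' B' C' : Set α} (hc : ConnSet G A ∧ ConnSet G B ∧ ConnSet G C)
    (hc' : ConnSet G A' ∧ ConnSet G B' ∧ ConnSet G C')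
    (hd : Disjoint A B ∧ Disjoint A C ∧ Disjoint B C)
    (hd' : Disjoint A' B' ∧ Disjoint A' C' ∧ Disjoint B' C')
    (hdd : (Disjoint A A' ∧ Disjoint A B' ∧ Disjoint A C') ∧
      (Disjoint B A' ∧ Disjoint B B' ∧ Disjoint B C') ∧
      (Disjoint C A' ∧ Disjoint C B' ∧ Disjoint C C'))
    (ht : Touch G A B ∧ Touch G A C ∧ Touch G B C)
    (ht' : Touch G A' B' ∧ Touch G A' C' ∧ Touch G B' C')
    (hr : Touch G A A' ∧ Touch G B B' ∧ Touch G C C') :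
    PrismModel G ![A, B, C] ![A', B', C'] := by
  constructor <;> simp [Fin.forall_fin_succ, *, disjoint_comm, touch_comm]

theorem k33Model_of_sets {A' B' C' : Set α} (hc : ConnSet G A ∧ ConnSet G B ∧ ConnSet G C)
    (hc' : ConnSet G A' ∧ ConnSet G B' ∧ ConnSet G C')
    (hd : Disjoint A B ∧ Disjoint A C ∧ Disjoint B C)
    (hd' : Disjoint A' B' ∧ Disjoint A' C' ∧ Disjoint B' C')
    (hdd : (Disjoint A A' ∧ Disjoint A B' ∧ Disjoint A C') ∧
      (Disjoint B A' ∧ Disjoint B B' ∧ Disjoint B C') ∧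
      (Disjoint C A' ∧ Disjoint C B' ∧ Disjoint C C'))
    (ht : (Touch G A A' ∧ Touch G A B' ∧ Touch G A C') ∧
      (Touch G B A' ∧ Touch G B B' ∧ Touch G B C') ∧
      (Touch G C A' ∧ Touch G C B' ∧ Touch G C C')) :
    K33Model G ![A, B, C] ![A', B', C'] := by
  constructor <;> simp [Fin.forall_fin_succ, *, Disjoint.symm]

theorem W4Model.rotate {H : Set α} (h : W4Model G H A B C D) : W4Model G H B C D A := by
  obtain ⟨hc, hd, hh, hr⟩ := h
  exact ⟨by grind, by grind [Disjoint.symm], by grind, by grind⟩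

/-- A proper part of the hub of a spanning model of the wheel with four spokes touches at most two
rim sets. -/
theorem K4Spanning.hub_part (hsp : K4Spanning G) {H H' : Set α} {x : α}
    (h : W4Model G H A B C D) (hH' : ConnSet G H') (hsub : H' ⊆ H) (hx : x ∈ H) (hx' : x ∉ H')
    (hA : Touch G H' A) (hB : Touch G H' B) (hC : Touch G H' C) : False := by
  obtain ⟨hc, hd, hh, hr⟩ := h
  have : K4Model G H' A B (C ∪ D) := by
    refine ⟨⟨hH', hc.2.1, hc.2.2.1, hc.2.2.2.1.union hc.2.2.2.2 hr.2.2.1⟩, ?_, ?_⟩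
    · simp only [Set.disjoint_left] at *
      grind
    · simp only [touch_union_right]
      grind [Touch.symm]
  have := hsp _ _ _ _ this x
  simp only [Set.disjoint_left] at *
  grind

theorem W4Model.prismModel {S T : Set α} (h : W4Model G (S ∪ T) A B C D) (hS : ConnSet G S)
    (hT : ConnSet G T) (hST : Disjoint S T) (tST : Touch G S T)
    (ht : Touch G S A ∧ Touch G S B ∧ Touch G T C ∧ Touch G T D) :
    PrismModel G ![S, A, B] ![T, D, C] := by
  obtain ⟨hc, hd, hh, hr⟩ := h
  refine prismModel_of_sets ?_ ?_ ?_ ?_ ?_ ?_ ?_ ?_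
  · grind
  · grind
  · simp only [Set.disjoint_left] at *
    grind
  · simp only [Set.disjoint_left] at *
    grind
  · simp only [Set.disjoint_left] at *
    grind
  · grind
  · grind [Touch.symm]
  · grind [Touch.symm]

theorem W4Model.k33Model {S T : Set α} (h : W4Model G (S ∪ T) A B C D) (hS : ConnSet G S)
    (hT : ConnSet G T) (hST : Disjoint S T) (tST : Touch G S T)
    (ht : Touch G S A ∧ Touch G S C ∧ Touch G T B ∧ Touch G T D) :
    K33Model G ![S, B, D] ![T, A, C] := by
  obtain ⟨hc, hd, hh, hr⟩ := h
  refine k33Model_of_sets ?_ ?_ ?_ ?_ ?_ ?_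
  · grind
  · grind
  · simp only [Set.disjoint_left] at *
    grind
  · simp only [Set.disjoint_left] at *
    grind
  · simp only [Set.disjoint_left] at *
    grind
  · grind [Touch.symm]

theorem K4Spanning.hub_subsingleton [Finite α] (hsp : K4Spanning G)
    (hp : ∀ X Y, ¬ PrismModel G X Y) (hk : ∀ X Y, ¬ K33Model G X Y) {H : Set α}
    (h : W4Model G H A B C D) : H.Subsingleton := by
  rw [← Set.not_nontrivial_iff]
  intro hH
  obtain ⟨x, hx, y, hy, hxy, hHx, -⟩ := h.conn.1.exists_two_diff hH
  have hU : {x} ∪ (H \ {x}) = H := by grind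
  have htx := h.conn.1.touch_of_union_eq hU Set.disjoint_sdiff_right ⟨x, rfl⟩ hHx.nonempty
  have hxc := connSet_singleton G x
  have hd₀ : Disjoint {x} (H \ {x}) := Set.disjoint_sdiff_right
  have hpart₁ : ∀ A B C D, W4Model G H A B C D →
      ¬ (Touch G {x} A ∧ Touch G {x} B ∧ Touch G {x} C) := fun A B C D h ⟨h₁, h₂, h₃⟩ ↦
    hsp.hub_part h hxc (by simpa using hx) hy (by simpa using hxy.symm) h₁ h₂ h₃
  have hpart₂ : ∀ A B C D, W4Model G H A B C D →
      ¬ (Touch G (H \ {x}) A ∧ Touch G (H \ {x}) B ∧ Touch G (H \ {x}) C) :=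
    fun A B C D h ⟨h₁, h₂, h₃⟩ ↦
    hsp.hub_part h hHx Set.sdiff_subset hx (by simp) h₁ h₂ h₃
  generalize H \ {x} = H' at *
  subst hU
  have hprism : ∀ A B C D, W4Model G ({x} ∪ H') A B C D →
      ¬ (Touch G {x} A ∧ Touch G {x} B ∧ Touch G H' C ∧ Touch G H' D) :=
    fun A B C D h ht ↦ hp _ _ (h.prismModel hxc hHx hd₀ htx ht)
  have hk33 : ∀ A B C D, W4Model G ({x} ∪ H') A B C D →
      ¬ (Touch G {x} A ∧ Touch G {x} C ∧ Touch G H' B ∧ Touch G H' D) :=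
    fun A B C D h ht ↦ hk _ _ (h.k33Model hxc hHx hd₀ htx ht)
  have hh := h.hub
  simp only [touch_union_left] at hh
  have r₁ := h.rotate
  have r₂ := r₁.rotate
  have r₃ := r₂.rotate
  have a₁ := hpart₁ _ _ _ _ h
  have a₂ := hpart₁ _ _ _ _ r₁
  have a₃ := hpart₁ _ _ _ _ r₂
  have a₄ := hpart₁ _ _ _ _ r₃
  have b₁ := hpart₂ _ _ _ _ h
  have b₂ := hpart₂ _ _ _ _ r₁
  have b₃ := hpart₂ _ _ _ _ r₂
  have b₄ := hpart₂ _ _ _ _ r₃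
  have c₁ := hprism _ _ _ _ h
  have c₂ := hprism _ _ _ _ r₁
  have c₃ := hprism _ _ _ _ r₂
  have c₄ := hprism _ _ _ _ r₃
  have d₁ := hk33 _ _ _ _ h
  have d₂ := hk33 _ _ _ _ r₁
  clear hpart₁ hpart₂ hprism hk33 h r₁ r₂ r₃ hsp hp hk
  rcases hh with ⟨h₁ | h₁, h₂ | h₂, h₃ | h₃, h₄ | h₄⟩ <;> simp_all only [not_true, and_self]

/-- Four pairwise disjoint connected sets around a hub, the first being a single rim vertex and the
other three touching the hub. -/
structure RimModel (G : SimpleGraph α) (h : α) (A P C Q : Set α) : Prop where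
  conn : ConnSet G A ∧ ConnSet G P ∧ ConnSet G C ∧ ConnSet G Q
  disj : Disjoint A P ∧ Disjoint A C ∧ Disjoint A Q ∧ Disjoint P C ∧ Disjoint P Q ∧ Disjoint C Q
  hub : h ∉ A ∧ h ∉ P ∧ h ∉ C ∧ h ∉ Q
  spoke : Touch G {h} P ∧ Touch G {h} C ∧ Touch G {h} Q
  rim : Touch G A P ∧ Touch G P C ∧ Touch G C Q ∧ Touch G Q A

theorem RimModel.reflect {h : α} {P Q : Set α} (hM : RimModel G h A P C Q) :
    RimModel G h A Q C P := by
  obtain ⟨hc, hd, hh, hs, hr⟩ := hM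
  exact ⟨by grind, by grind [Disjoint.symm], by grind, by grind, by grind [Touch.symm]⟩

theorem K4Spanning.rim_part (hsp : K4Spanning G) {h x : α} {P Q A' : Set α}
    (hM : RimModel G h A P C Q) (hA' : ConnSet G A') (hsub : A' ⊆ A) (hx : x ∈ A) (hx' : x ∉ A')
    (hP : Touch G A' P) (hQ : Touch G A' Q) : False := by
  obtain ⟨hc, hd, hh, hs, hr⟩ := hM
  have : K4Model G {h} (P ∪ A') C Q := by
    refine ⟨⟨connSet_singleton G h, hc.2.1.union hA' hP.symm, hc.2.2⟩, ?_, ?_⟩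
    · simp only [Set.disjoint_left] at *
      grind
    · simp only [touch_union_right, touch_union_left]
      grind [Touch.symm]
  have := hsp _ _ _ _ this x
  simp only [Set.disjoint_left] at *
  grind

/-- One can shrink the first rim set to any of its vertices by moving the other ones to its
neighbour rim sets. -/
theorem K4Spanning.shrink_rim [Finite α] (hsp : K4Spanning G) {h v : α} {P Q : Set α}
    (hM : RimModel G h A P C Q) (hv : v ∈ A) :
    ∃ P' Q', RimModel G h {v} P' C Q' ∧ {v} ∪ P' ∪ Q' = A ∪ P ∪ Q := by
  induction hn : A.ncard using Nat.strong_induction_on generalizing A P Q with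
  | _ n ih =>
  by_cases hA : A = {v}
  · exact ⟨P, Q, hA ▸ hM, by rw [hA]⟩
  obtain ⟨w, hw, hwv⟩ : ∃ w ∈ A, w ≠ v := by
    by_contra! hno
    exact hA (by grind)
  obtain ⟨x, hx, hxv, hAx⟩ := hM.conn.1.exists_ne_diff hv hw hwv
  have hU : {x} ∪ (A \ {x}) = A := by grind
  have hlt : (A \ {x}).ncard < n := hn ▸ Set.ncard_sdiff_singleton_lt_of_mem hx
  have key : ∀ P Q, RimModel G h A P C Q → Touch G (A \ {x}) P → ¬ Touch G (A \ {x}) Q →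
      RimModel G h (A \ {x}) P C ({x} ∪ Q) := by
    rintro P Q ⟨hc, hd, hh, hs, hr⟩ hP hQ
    have htx := hc.1.touch_of_union_eq hU Set.disjoint_sdiff_right ⟨x, rfl⟩ hAx.nonempty
    have hsub : A \ {x} ⊆ A := Set.sdiff_subset
    have hxA : x ∉ A \ {x} := by simp
    have hxQ : Touch G {x} Q := by
      have := hr.2.2.2.symm
      rw [← hU, touch_union_left] at this
      exact this.resolve_right hQ
    generalize A \ {x} = A' at *
    refine ⟨⟨hAx, hc.2.1, hc.2.2.1, (connSet_singleton G x).union hc.2.2.2 hxQ⟩, ?_, ?_, ?_, ?_⟩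
    · simp only [Set.disjoint_left] at *
      grind
    · grind
    · simp only [touch_union_right]
      grind
    · simp only [touch_union_right, touch_union_left]
      grind
  by_cases hP : Touch G (A \ {x}) P
  · have hQ : ¬ Touch G (A \ {x}) Q := fun hQ ↦
      hsp.rim_part hM hAx Set.sdiff_subset hx (by simp) hP hQ
    obtain ⟨P', Q', hM', hE⟩ := ih _ hlt (key P Q hM hP hQ) ⟨hv, hxv.symm⟩ rfl
    exact ⟨P', Q', hM', by rw [hE]; grind⟩
  · have hQ : Touch G (A \ {x}) Q := by
      by_contra hQ
      have h₁ := hM.rim.1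
      have h₂ := hM.rim.2.2.2.symm
      rw [← hU, touch_union_left] at h₁ h₂
      exact hsp.rim_part hM (connSet_singleton G x) (by simpa using hx) hv (by simpa using hxv.symm)
        (h₁.resolve_right hP) (h₂.resolve_right hQ)
    obtain ⟨Q', P', hM', hE⟩ := ih _ hlt (key Q P hM.reflect hQ hP) ⟨hv, hxv.symm⟩ rfl
    exact ⟨Q', P', hM', by rw [hE]; grind⟩

theorem K4Spanning.rim_neighbor_unique [Finite α] (hsp : K4Spanning G)
    (hpr : ∀ X Y, ¬ PrismModel G X Y) {h v : α} {P Q : Set α} (hM : RimModel G h {v} P C Q)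
    {p q : α} (hp : p ∈ P) (hq : q ∈ P) (hvp : G.Adj v p) (hvq : G.Adj v q) : p = q := by
  by_contra hpq
  obtain ⟨hc, hd, hh, hs, hr⟩ := hM
  obtain ⟨R, S, hR, hS, hpR, hqS, hRS, rfl⟩ := hc.2.1.exists_split hp hq hpq
  have tRS : Touch G R S := hc.2.1.touch_of_union_eq rfl hRS ⟨p, hpR⟩ ⟨q, hqS⟩
  have tvR : Touch G {v} R := ⟨v, rfl, p, hpR, hvp⟩
  have tvS : Touch G {v} S := ⟨v, rfl, q, hqS, hvq⟩
  have hhc := connSet_singleton G h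
  have hvh : v ≠ h := by grind
  have key : ∀ R S : Set α, ConnSet G R → ConnSet G S → S.Nonempty → Disjoint R S →
      Disjoint {v} (R ∪ S) ∧ Disjoint (R ∪ S) C ∧ Disjoint (R ∪ S) Q → h ∉ R ∪ S →
      Touch G {v} R → Touch G R C → Touch G {h} R → False := by
    rintro R S hR hS ⟨s, hs⟩ hRS hdd hhRS tvR tRC thR
    have : K4Model G {h} ({v} ∪ R) C Q := by
      refine ⟨⟨hhc, hc.1.union hR tvR, hc.2.2⟩, ?_, ?_⟩
      · simp only [Set.disjoint_left] at *
        grind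
      · simp only [touch_union_right, touch_union_left]
        grind [Touch.symm]
    have := hsp _ _ _ _ this s
    simp only [Set.disjoint_left] at *
    grind
  have key' : ∀ R S : Set α, ConnSet G R → ConnSet G S → Disjoint R S →
      Disjoint {v} (R ∪ S) ∧ Disjoint (R ∪ S) C ∧ Disjoint (R ∪ S) Q → h ∉ R ∪ S →
      Touch G {v} R → Touch G {v} S → Touch G R S → Touch G R C → Touch G {h} S → False := by
    intro R S hR hS hRS hdd hhRS tvR tvS tRS tRC thS
    refine hpr ![{v}, R, S] ![Q, C, {h}] (prismModel_of_sets ?_ ?_ ?_ ?_ ?_ ?_ ?_ ?_)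
    · grind
    · grind
    · simp only [Set.disjoint_left] at *
      grind
    · simp only [Set.disjoint_left] at *
      grind
    · simp only [Set.disjoint_left] at *
      grind
    · grind
    · grind [Touch.symm]
    · grind [Touch.symm]
  have hdd : Disjoint {v} (R ∪ S) ∧ Disjoint (R ∪ S) C ∧ Disjoint (R ∪ S) Q := by grind
  have hswap : S ∪ R = R ∪ S := Set.union_comm _ _
  have h₁ := key R S hR hS ⟨q, hqS⟩ hRS hdd hh.2.1 tvR
  have h₂ := key S R hS hR ⟨p, hpR⟩ hRS.symm (by rwa [hswap]) (by rw [hswap]; exact hh.2.1) tvS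
  have h₃ := key' R S hR hS hRS hdd hh.2.1 tvR tvS tRS
  have h₄ := key' S R hS hR hRS.symm (by rwa [hswap]) (by rw [hswap]; exact hh.2.1) tvS tvR
    tRS.symm
  have h₅ := hs.1
  have h₆ := hr.2.1
  rw [touch_union_left] at h₆
  rw [touch_union_right] at h₅
  tauto

/-- In a spanning model of the wheel with four spokes whose hub is a single vertex, every rim vertex
has exactly two neighbours different from the hub. -/
theorem K4Spanning.rim_degree [Finite α] (hsp : K4Spanning G)
    (hpr : ∀ X Y, ¬ PrismModel G X Y) {h v : α} (hM : W4Model G {h} A B C D) (hv : v ∈ A) :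
    (G.neighborSet v \ {h}).ncard = 2 := by
  obtain ⟨hc, hd, hh, hr⟩ := hM
  have hcover : ∀ x, x = h ∨ x ∈ A ∨ x ∈ B ∨ x ∈ C ∨ x ∈ D := by
    have : K4Model G {h} A B (C ∪ D) := by
      refine ⟨⟨hc.1, hc.2.1, hc.2.2.1, hc.2.2.2.1.union hc.2.2.2.2 hr.2.2.1⟩, ?_, ?_⟩
      · simp only [Set.disjoint_left] at *
        grind
      · simp only [touch_union_right]
        grind [Touch.symm]
    intro x
    have := hsp _ _ _ _ this x
    simp only [Set.mem_union, Set.mem_singleton_iff] at this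
    grind
  have hAC : ¬ Touch G A C := by
    intro hAC
    obtain ⟨b, hb⟩ := hc.2.2.1.nonempty
    have := hsp {h} A C D ⟨by grind, by grind, by grind [Touch.symm]⟩ b
    simp only [Set.disjoint_left] at *
    grind
  have hR : RimModel G h A B C D := by
    refine ⟨hc.2, hd.2.2.2.2, ?_, by grind, by grind⟩
    simp only [Set.disjoint_left] at *
    grind
  obtain ⟨P, Q, hM, hE⟩ := hsp.shrink_rim hR hv
  have hP := fun p hp q hq ↦ hsp.rim_neighbor_unique hpr hM (p := p) (q := q) hp hq
  have hQ := fun p hp q hq ↦ hsp.rim_neighbor_unique hpr hM.reflect (p := p) (q := q) hp hq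
  obtain ⟨p, hpP, hvp⟩ : ∃ p ∈ P, G.Adj v p := by simpa [Touch] using hM.rim.1
  obtain ⟨q, hqQ, hqv⟩ : ∃ q ∈ Q, G.Adj q v := by simpa [Touch] using hM.rim.2.2.2
  have hdisj := hM.disj
  have hhub := hM.hub
  have : G.neighborSet v \ {h} = {p, q} := by
    ext y
    simp only [Set.mem_sdiff, mem_neighborSet, Set.mem_singleton_iff, Set.mem_insert_iff]
    constructor
    · rintro ⟨hvy, hyh⟩
      have hyC : y ∉ C := fun hyC ↦ hAC ⟨v, hv, y, hyC, hvy⟩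
      have hyv := hvy.ne'
      have := hcover y
      have hy : y ∈ {v} ∪ P ∪ Q := by
        rw [hE]
        simp only [Set.mem_union]
        grind
      simp only [Set.mem_union, Set.mem_singleton_iff] at hy
      rcases hy with (hy | hy) | hy
      · exact absurd hy hyv
      · exact Or.inl (hP y hy p hpP hvy hvp)
      · exact Or.inr (hQ y hy q hqQ hvy hqv.symm)
    · rintro (rfl | rfl)
      · exact ⟨hvp, fun h ↦ hhub.2.1 (h ▸ hpP)⟩
      · exact ⟨hqv.symm, fun h ↦ hhub.2.2.2 (h ▸ hqQ)⟩
  rw [this, Set.ncard_pair]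
  rintro rfl
  exact Set.disjoint_left.1 hdisj.2.2.2.2.1 hpP hqQ

theorem K4Spanning.isWheel [Finite α] (hsp : K4Spanning G) (hpr : ∀ X Y, ¬ PrismModel G X Y)
    (hk : ∀ X Y, ¬ K33Model G X Y) {H : Set α} (hM : W4Model G H A B C D) : IsWheel G := by
  obtain ⟨h, rfl⟩ : ∃ h, H = {h} :=
    (hsp.hub_subsingleton hpr hk hM).eq_empty_or_singleton.resolve_left hM.conn.1.nonempty.ne_empty
  have hdeg := fun v hv ↦ hsp.rim_degree hpr hM (v := v) hv
  have hdeg₁ := fun v hv ↦ hsp.rim_degree hpr hM.rotate (v := v) hv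
  have hdeg₂ := fun v hv ↦ hsp.rim_degree hpr hM.rotate.rotate (v := v) hv
  have hdeg₃ := fun v hv ↦ hsp.rim_degree hpr hM.rotate.rotate.rotate (v := v) hv
  obtain ⟨hc, hd, hh, hr⟩ := hM
  have hCD := hc.2.2.2.1.union hc.2.2.2.2 hr.2.2.1
  have hcover : ∀ x, x = h ∨ x ∈ A ∨ x ∈ B ∨ x ∈ C ∨ x ∈ D := by
    have : K4Model G {h} A B (C ∪ D) := by
      refine ⟨⟨hc.1, hc.2.1, hc.2.2.1, hCD⟩, ?_, ?_⟩
      · simp only [Set.disjoint_left] at *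
        grind
      · simp only [touch_union_right]
        grind [Touch.symm]
    intro x
    have := hsp _ _ _ _ this x
    simp only [Set.mem_union, Set.mem_singleton_iff] at this
    grind
  refine ⟨h, ⟨?_, ?_⟩, ?_⟩
  · have : {u | u ≠ h} = (A ∪ B) ∪ (C ∪ D) := by
      ext u
      have := hcover u
      simp only [Set.disjoint_left] at hd
      simp only [Set.mem_ofPred_eq, Set.mem_union]
      grind
    rw [this]
    refine (hc.2.1.union hc.2.2.1 hr.1).union hCD ?_
    simp only [touch_union_left, touch_union_right]
    grind
  · rintro ⟨u, hu⟩
    have h₂ : (G.neighborSet u \ {h}).ncard = 2 := by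
      rcases hcover u with h' | h' | h' | h' | h'
      · exact absurd h' hu
      · exact hdeg u h'
      · exact hdeg₁ u h'
      · exact hdeg₂ u h'
      · exact hdeg₃ u h'
    rw [← h₂, ← Set.ncard_image_of_injective _ Subtype.val_injective]
    congr 1
    ext y
    simp [and_comm]
  · obtain ⟨_, rfl, a, ha, hha⟩ := hh.1
    obtain ⟨_, rfl, b, hb, hhb⟩ := hh.2.1
    obtain ⟨_, rfl, c, hcC, hhc⟩ := hh.2.2.1
    have : ({a, b, c} : Set α).ncard = 3 := by
      rw [Set.ncard_eq_three]
      simp only [Set.disjoint_left] at hd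
      exact ⟨a, b, c, by grind, by grind, by grind, rfl⟩
    rw [← this]
    refine Set.ncard_le_ncard ?_ (Set.toFinite _)
    rintro y (rfl | rfl | rfl) <;> assumption

theorem K33Model.swap {X Y : Fin 3 → Set α} (hM : K33Model G X Y) : K33Model G Y X :=
  ⟨hM.connY, hM.connX, hM.disjY, hM.disjX, fun i j ↦ (hM.disjXY j i).symm,
    fun i j ↦ (hM.touch j i).symm⟩

theorem exists_pair : ∀ i : Fin 3, ∃ j k, i ≠ j ∧ i ≠ k ∧ j ≠ k := by decide

theorem exists_third : ∀ i j : Fin 3, i ≠ j → ∃ k, i ≠ k ∧ j ≠ k := by decide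

/-- In a spanning model of `K₃,₃`, a connected part of a branch set touching two of the opposite
branch sets is the entire branch set. -/
theorem K4Spanning.k33_part (hsp : K4Spanning G) {X Y : Fin 3 → Set α} (hM : K33Model G X Y)
    {i a b : Fin 3} (hab : a ≠ b) {X' : Set α} (hX' : ConnSet G X') (hsub : X' ⊆ X i)
    (ha : Touch G X' (Y a)) (hb : Touch G X' (Y b)) (z : α) :
    z ∈ X' ∨ (∃ j ≠ i, z ∈ X j) ∨ ∃ c, z ∈ Y c := by
  obtain ⟨j, k, hij, hik, hjk⟩ : ∃ j k, i ≠ j ∧ i ≠ k ∧ j ≠ k := exists_pair i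
  obtain ⟨c, hac, hbc⟩ := exists_third a b hab
  have d₁ := (hM.disjXY i b).mono_left hsub
  have d₂ := (hM.disjXY i c).mono_left hsub
  have d₃ := (hM.disjX i j hij).mono_left hsub
  have d₄ := (hM.disjX i k hik).mono_left hsub
  have : K4Model G (Y a ∪ X') (Y b) (X j ∪ Y c) (X k) := by
    refine ⟨⟨(hM.connY a).union hX' ha.symm, hM.connY b, (hM.connX j).union (hM.connY c)
      (hM.touch j c), hM.connX k⟩, ?_, ?_⟩
    · simp only [Set.disjoint_union_left, Set.disjoint_union_right]
      have := fun i j ↦ (hM.disjXY i j).symm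
      exact ⟨⟨hM.disjY _ _ hab, d₁⟩, ⟨⟨this _ _, d₃⟩, hM.disjY _ _ hac, d₂⟩, ⟨this _ _, d₄⟩,
        ⟨this _ _, hM.disjY _ _ hbc⟩, this _ _, hM.disjX _ _ hjk, this _ _⟩
    · simp only [touch_union_left, touch_union_right]
      have := fun i j ↦ (hM.touch i j).symm
      exact ⟨Or.inr hb, Or.inl (Or.inl (this _ _)), Or.inl (this _ _), Or.inl (this _ _),
        this _ _, Or.inr (this _ _)⟩
  have := hsp _ _ _ _ this z
  grind

theorem K4Spanning.k33_subsingleton [Finite α] (hsp : K4Spanning G) {X Y : Fin 3 → Set α}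
    (hM : K33Model G X Y) (i : Fin 3) : (X i).Subsingleton := by
  rw [← Set.not_nontrivial_iff]
  intro hX
  obtain ⟨x, hx, y, hy, hxy, hc, -⟩ := (hM.connX i).exists_two_diff hX
  have hout : ∀ z ∈ X i, ¬ ((∃ j ≠ i, z ∈ X j) ∨ ∃ c, z ∈ Y c) := by
    rintro z hz (⟨j, hj, hzj⟩ | ⟨c, hzc⟩)
    · exact Set.disjoint_left.1 (hM.disjX _ _ hj) hzj hz
    · exact Set.disjoint_left.1 (hM.disjXY _ _) hz hzc
  have h₁ : ∀ a b, a ≠ b → Touch G {x} (Y a) → ¬ Touch G {x} (Y b) := fun a b hab ha hb ↦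
    hout y hy ((hsp.k33_part hM hab (connSet_singleton G x) (by simpa using hx) ha hb y).resolve_left
      (by simpa using hxy.symm))
  have h₂ : ∀ a b, a ≠ b → Touch G (X i \ {x}) (Y a) → ¬ Touch G (X i \ {x}) (Y b) :=
    fun a b hab ha hb ↦
    hout x hx ((hsp.k33_part hM hab hc Set.sdiff_subset ha hb x).resolve_left (by simp))
  have h₃ : ∀ a, Touch G {x} (Y a) ∨ Touch G (X i \ {x}) (Y a) := by
    intro a
    rw [← touch_union_left, Set.union_sdiff_cancel (by simpa using hx)]
    exact hM.touch i a
  have h01 : (0 : Fin 3) ≠ 1 := by decide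
  have h02 : (0 : Fin 3) ≠ 2 := by decide
  have h12 : (1 : Fin 3) ≠ 2 := by decide
  rcases h₃ 0 with t₀ | t₀ <;> rcases h₃ 1 with t₁ | t₁ <;> rcases h₃ 2 with t₂ | t₂ <;> grind

theorem K4Spanning.k33_not_touch (hsp : K4Spanning G) {X Y : Fin 3 → Set α}
    (hM : K33Model G X Y) {i j : Fin 3} (hij : i ≠ j) : ¬ Touch G (X i) (X j) := by
  intro ht
  obtain ⟨k, hik, hjk⟩ := exists_third i j hij
  have t := fun i j ↦ (hM.touch i j).symm
  have d := fun i j ↦ (hM.disjXY i j).symm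
  have : K4Model G (Y 1 ∪ X k) (Y 2) (X i) (X j) := by
    refine ⟨⟨(hM.connY _).union (hM.connX _) (t _ _), hM.connY _, hM.connX _, hM.connX _⟩, ?_, ?_⟩
    · simp only [Set.disjoint_union_left]
      exact ⟨⟨hM.disjY _ _ (by decide), hM.disjXY _ _⟩, ⟨d _ _, hM.disjX _ _ hik.symm⟩,
        ⟨d _ _, hM.disjX _ _ hjk.symm⟩, d _ _, d _ _, hM.disjX _ _ hij⟩
    · simp only [touch_union_left]
      exact ⟨Or.inr (hM.touch _ _), Or.inl (t _ _), Or.inl (t _ _), t _ _, t _ _, ht⟩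
  obtain ⟨z, hz⟩ := (hM.connY 0).nonempty
  have h₁ := Set.disjoint_left.1 (hM.disjY 0 1 (by decide)) hz
  have h₂ := Set.disjoint_left.1 (hM.disjY 0 2 (by decide)) hz
  have h₃ := fun i ↦ Set.disjoint_left.1 (d i 0) hz
  have := hsp _ _ _ _ this z
  grind

theorem K4Spanning.iso_completeBipartiteGraph [Finite α] (hsp : K4Spanning G)
    {X Y : Fin 3 → Set α} (hM : K33Model G X Y) :
    Nonempty (G ≃g completeBipartiteGraph (Fin 3) (Fin 3)) := by
  have hX : ∀ i, ∃ x, X i = {x} := fun i ↦ (hsp.k33_subsingleton hM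
    i).eq_empty_or_singleton.resolve_left (hM.connX i).nonempty.ne_empty
  have hY : ∀ i, ∃ x, Y i = {x} := fun i ↦ (hsp.k33_subsingleton hM.swap
    i).eq_empty_or_singleton.resolve_left (hM.connY i).nonempty.ne_empty
  choose x hx using hX
  choose y hy using hY
  have hcover : ∀ z, (∃ i, x i = z) ∨ ∃ i, y i = z := by
    intro z
    have := hsp.k33_part hM (show (0 : Fin 3) ≠ 1 by decide) (hM.connX 0) subset_rfl
      (hM.touch 0 0) (hM.touch 0 1) z
    simp only [hx, hy, Set.mem_singleton_iff] at this
    grind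
  obtain rfl : X = fun i ↦ {x i} := funext hx
  obtain rfl : Y = fun i ↦ {y i} := funext hy
  have tX := fun i j (h : i ≠ j) ↦ hsp.k33_not_touch hM h
  have tY := fun i j (h : i ≠ j) ↦ hsp.k33_not_touch hM.swap h
  obtain ⟨-, -, dX, dY, dXY, t⟩ := hM
  simp only [Set.disjoint_singleton] at dX dY dXY
  simp only [Touch, Set.mem_singleton_iff, exists_eq_left] at t tX tY
  have hbij : Function.Bijective (Sum.elim x y) := by
    refine ⟨Function.Injective.sumElim (fun i j h ↦ ?_) (fun i j h ↦ ?_) dXY, fun z ↦ ?_⟩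
    · exact by_contra fun hij ↦ dX i j hij h
    · exact by_contra fun hij ↦ dY i j hij h
    · rcases hcover z with ⟨i, hi⟩ | ⟨i, hi⟩
      · exact ⟨Sum.inl i, hi⟩
      · exact ⟨Sum.inr i, hi⟩
  refine ⟨(RelIso.symm ⟨Equiv.ofBijective _ hbij, ?_⟩)⟩
  rintro (i | i) (j | j)
  · by_cases hij : i = j
    · simp [hij]
    · simpa using tX i j hij
  · simpa using t i j
  · simpa using (t j i).symm
  · by_cases hij : i = j
    · simp [hij]
    · simpa using tY i j hij

theorem PrismModel.swap {X Y : Fin 3 → Set α} (hM : PrismModel G X Y) : PrismModel G Y X :=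
  ⟨hM.connY, hM.connX, hM.disjY, hM.disjX, fun i j ↦ (hM.disjXY j i).symm, hM.touchY, hM.touchX,
    fun i ↦ (hM.rung i).symm⟩

/-- In a spanning model of the prism, a connected part of a rung touching three of the branch sets
outside of it is the entire rung. -/
theorem K4Spanning.prism_part (hsp : K4Spanning G) {X Y : Fin 3 → Set α} (hM : PrismModel G X Y)
    {i j k : Fin 3} (hij : i ≠ j) (hik : i ≠ k) (hjk : j ≠ k) {W : Set α} (hW : ConnSet G W)
    (hsub : W ⊆ X i ∪ Y i) (hX : Touch G W (X k)) (hj : Touch G W (Y j)) (hk : Touch G W (Y k))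
    (z : α) : z ∈ W ∨ ∃ l ≠ i, z ∈ X l ∪ Y l := by
  have d := fun i j ↦ (hM.disjXY i j).symm
  have dX : ∀ l, i ≠ l → Disjoint W (X l) := fun l hl ↦ Disjoint.mono_left hsub
    (Set.disjoint_union_left.2 ⟨hM.disjX _ _ hl, d _ _⟩)
  have dY : ∀ l, i ≠ l → Disjoint W (Y l) := fun l hl ↦ Disjoint.mono_left hsub
    (Set.disjoint_union_left.2 ⟨hM.disjXY _ _, hM.disjY _ _ hl⟩)
  have : K4Model G W (X k) (X j ∪ Y j) (Y k) := by
    refine ⟨⟨hW, hM.connX k, (hM.connX j).union (hM.connY j) (hM.rung j), hM.connY k⟩, ?_, ?_⟩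
    · simp only [Set.disjoint_union_left, Set.disjoint_union_right]
      exact ⟨dX _ hik, ⟨dX _ hij, dY _ hij⟩, dY _ hik, ⟨hM.disjX _ _ hjk.symm, hM.disjXY _ _⟩,
        hM.disjXY _ _, hM.disjXY _ _, hM.disjY _ _ hjk⟩
    · simp only [touch_union_left, touch_union_right]
      exact ⟨hX, Or.inr hj, hk, Or.inl (hM.touchX _ _ hjk.symm), hM.rung k,
        Or.inr (hM.touchY _ _ hjk)⟩
  have := hsp _ _ _ _ this z
  grind

theorem PrismModel.disjoint_rung {X Y : Fin 3 → Set α} (hM : PrismModel G X Y) {i l : Fin 3}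
    (hil : i ≠ l) : Disjoint (X i ∪ Y i) (X l ∪ Y l) := by
  simp only [Set.disjoint_union_left, Set.disjoint_union_right]
  exact ⟨⟨hM.disjX _ _ hil, (hM.disjXY _ _).symm⟩, hM.disjXY _ _, hM.disjY _ _ hil⟩

theorem K4Spanning.prism_part_eq (hsp : K4Spanning G) {X Y : Fin 3 → Set α}
    (hM : PrismModel G X Y) {i j : Fin 3} (hij : i ≠ j) {W : Set α} (hW : ConnSet G W)
    (hsub : W ⊆ X i ∪ Y i) (hX : Touch G W (X j)) (hY : ∀ l ≠ i, Touch G W (Y l)) :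
    W = X i ∪ Y i := by
  obtain ⟨k, hik, hjk⟩ := exists_third i j hij
  refine hsub.antisymm fun z hz ↦ ?_
  refine (hsp.prism_part hM hik hij hjk.symm hW hsub hX (hY k hik.symm) (hY j hij.symm)
    z).resolve_right ?_
  rintro ⟨l, hl, hzl⟩
  exact Set.disjoint_left.1 (hM.disjoint_rung hl) hzl hz

/-- In a spanning model of the prism, the first triangle meets each of its branch sets in a single
vertex. -/
theorem K4Spanning.prism_apex [Finite α] (hsp : K4Spanning G) {X Y : Fin 3 → Set α}
    (hM : PrismModel G X Y) (i : Fin 3) : ∃ x ∈ X i, (∀ j ≠ i, ¬ Touch G (X i \ {x}) (X j)) ∧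
      (X i = {x} ∨ ConnSet G (X i \ {x}) ∧ Touch G (X i \ {x}) (Y i)) := by
  by_cases hX : (X i).Subsingleton
  · obtain ⟨x, hx⟩ := hX.eq_empty_or_singleton.resolve_left (hM.connX i).nonempty.ne_empty
    refine ⟨x, by simp [hx], fun j _ ↦ ?_, Or.inl hx⟩
    simp [hx, Touch]
  obtain ⟨x, hx, y, hy, hxy, hcx, hcy⟩ := (hM.connX i).exists_two_diff (Set.not_subsingleton_iff.1 hX)
  have key : ∀ x ∈ X i, ConnSet G (X i \ {x}) → Touch G (X i \ {x}) (Y i) →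
      ∀ j ≠ i, ¬ Touch G (X i \ {x}) (X j) := by
    intro x hx hc ht j hj htj
    have := hsp.prism_part_eq hM hj.symm (hc.union (hM.connY i) ht)
      (Set.union_subset_union_left _ Set.sdiff_subset) (touch_union_left.2 (Or.inl htj))
      fun l hl ↦ touch_union_left.2 (Or.inr (hM.touchY _ _ hl.symm))
    have hxU : x ∈ X i \ {x} ∪ Y i := this ▸ Or.inl hx
    exact hxU.elim (fun h ↦ h.2 rfl) (Set.disjoint_left.1 (hM.disjXY _ _) hx)
  by_cases ht : Touch G (X i \ {x}) (Y i)
  · exact ⟨x, hx, key x hx hcx ht, Or.inr ⟨hcx, ht⟩⟩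
  · have ht' : Touch G (X i \ {y}) (Y i) := by
      have h := hM.rung i
      rw [← Set.union_sdiff_cancel (s := {x}) (t := X i) (by simpa using hx), touch_union_left] at h
      exact (h.resolve_right ht).mono (by simpa using ⟨hx, hxy⟩) subset_rfl
    exact ⟨y, hy, key y hy hcy ht', Or.inr ⟨hcy, ht'⟩⟩

theorem K4Spanning.exists_prismModel_subsingleton [Finite α] (hsp : K4Spanning G)
    {X Y : Fin 3 → Set α} (hM : PrismModel G X Y) (i : Fin 3) :
    ∃ X' Y', PrismModel G X' Y' ∧ (X' i).Subsingleton ∧ ∀ j ≠ i, X' j = X j := by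
  obtain ⟨x, hx, hj, hx' | ⟨hc, ht⟩⟩ := hsp.prism_apex hM i
  · exact ⟨X, Y, hM, by simp [hx'], fun _ _ ↦ rfl⟩
  have hU : {x} ∪ (X i \ {x}) = X i := Set.union_sdiff_cancel (by simpa using hx)
  have htx := (hM.connX i).touch_of_union_eq hU Set.disjoint_sdiff_right ⟨x, rfl⟩ hc.nonempty
  have tX : ∀ j ≠ i, Touch G {x} (X j) := by
    intro j hji
    have h := hM.touchX i j hji.symm
    rw [← hU, touch_union_left] at h
    exact h.resolve_right (hj j hji)
  have hxs : {x} ⊆ X i := by simpa using hx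
  have hd : Disjoint {x} (X i \ {x}) := Set.disjoint_sdiff_right
  have hs : X i \ {x} ⊆ X i := Set.sdiff_subset
  obtain ⟨cX, cY, dX, dY, dXY, tX', tY, r⟩ := hM
  generalize X i \ {x} = S at *
  refine ⟨fun j ↦ if j = i then {x} else X j, fun j ↦ if j = i then Y i ∪ S else Y j,
    ⟨fun j ↦ ?_, fun j ↦ ?_, fun j k hjk ↦ ?_, fun j k hjk ↦ ?_, fun j k ↦ ?_, fun j k hjk ↦ ?_,
      fun j k hjk ↦ ?_, fun j ↦ ?_⟩, by simp, fun j hji ↦ by simp [hji]⟩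
  · split_ifs
    · exact connSet_singleton G x
    · exact cX j
  · split_ifs
    · exact (cY i).union hc ht.symm
    · exact cY j
  · split_ifs with h₁ h₂ h₂
    · exact absurd (h₁.trans h₂.symm) hjk
    · exact (dX i k (Ne.symm h₂)).mono_left hxs
    · exact (dX j i h₁).mono_right hxs
    · exact dX j k hjk
  · split_ifs with h₁ h₂ h₂
    · exact absurd (h₁.trans h₂.symm) hjk
    · exact Set.disjoint_union_left.2 ⟨dY _ _ (Ne.symm h₂), (dXY i k).mono_left hs⟩
    · exact Set.disjoint_union_right.2 ⟨dY _ _ h₁, (dXY i j).symm.mono_right hs⟩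
    · exact dY j k hjk
  · split_ifs with h₁ h₂ h₂
    · exact Set.disjoint_union_right.2 ⟨(dXY i i).mono_left hxs, hd⟩
    · exact (dXY i k).mono_left hxs
    · exact Set.disjoint_union_right.2 ⟨dXY j i, (dX j i h₁).mono_right hs⟩
    · exact dXY j k
  · split_ifs with h₁ h₂ h₂
    · exact absurd (h₁.trans h₂.symm) hjk
    · exact tX k h₂
    · exact (tX j h₁).symm
    · exact tX' j k hjk
  · split_ifs with h₁ h₂ h₂
    · exact absurd (h₁.trans h₂.symm) hjk
    · exact touch_union_left.2 (Or.inl (tY _ _ (Ne.symm h₂)))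
    · exact touch_union_right.2 (Or.inl (tY _ _ h₁))
    · exact tY j k hjk
  · split_ifs with h₁
    · exact touch_union_right.2 (Or.inr htx)
    · exact r j

theorem K4Spanning.exists_prismModel_singleton [Finite α] (hsp : K4Spanning G)
    {X Y : Fin 3 → Set α} (hM : PrismModel G X Y) :
    ∃ (x : Fin 3 → α) (Y' : Fin 3 → Set α), PrismModel G (fun i ↦ {x i}) Y' := by
  obtain ⟨X₀, Y₀, hM₀, h₀, -⟩ := hsp.exists_prismModel_subsingleton hM 0
  obtain ⟨X₁, Y₁, hM₁, h₁, h₁'⟩ := hsp.exists_prismModel_subsingleton hM₀ 1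
  obtain ⟨X₂, Y₂, hM₂, h₂, h₂'⟩ := hsp.exists_prismModel_subsingleton hM₁ 2
  rw [← h₁' 0 (by decide), ← h₂' 0 (by decide)] at h₀
  rw [← h₂' 1 (by decide)] at h₁
  have h : ∀ i, (X₂ i).Subsingleton := by
    intro i
    fin_cases i <;> assumption
  have hX : ∀ i, ∃ x, X₂ i = {x} := fun i ↦
    (h i).eq_empty_or_singleton.resolve_left (hM₂.connX i).nonempty.ne_empty
  choose x hx using hX
  obtain rfl : X₂ = fun i ↦ {x i} := funext hx
  exact ⟨x, Y₂, hM₂⟩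

theorem K4Spanning.prism_not_touch (hsp : K4Spanning G) {X Y : Fin 3 → Set α}
    (hM : PrismModel G X Y) {i j : Fin 3} (hij : i ≠ j) : ¬ Touch G (X i) (Y j) := by
  intro ht
  obtain ⟨k, hik, hjk⟩ := exists_third i j hij
  have : K4Model G (X i ∪ X k) (Y i) (Y j) (Y k) := by
    refine ⟨⟨(hM.connX _).union (hM.connX _) (hM.touchX _ _ hik), hM.connY _, hM.connY _,
      hM.connY _⟩, ?_, ?_⟩
    · simp only [Set.disjoint_union_left]
      have := hM.disjXY
      exact ⟨⟨this _ _, this _ _⟩, ⟨this _ _, this _ _⟩, ⟨this _ _, this _ _⟩, hM.disjY _ _ hij,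
        hM.disjY _ _ hik, hM.disjY _ _ hjk⟩
    · simp only [touch_union_left]
      exact ⟨Or.inl (hM.rung i), Or.inl ht, Or.inr (hM.rung k), hM.touchY _ _ hij,
        hM.touchY _ _ hik, hM.touchY _ _ hjk⟩
  obtain ⟨z, hz⟩ := (hM.connX j).nonempty
  have h₁ := Set.disjoint_left.1 (hM.disjX j i hij.symm) hz
  have h₂ := Set.disjoint_left.1 (hM.disjX j k hjk) hz
  have h₃ := fun i ↦ Set.disjoint_left.1 (hM.disjXY j i) hz
  have := hsp _ _ _ _ this z
  grind

/-- A minimal connected set containing two given vertices is the vertex set of an induced path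
between them. -/
theorem ConnSet.exists_inducedPath [Finite α] {a b : α} (hA : ConnSet G A) (ha : a ∈ A) (hb : b ∈ A)
    (hmin : ∀ W ⊆ A, ConnSet G W → a ∈ W → b ∈ W → W = A) :
    ∃ p : G.Walk a b, p.IsPath ∧ (∀ z, z ∈ p.support ↔ z ∈ A) ∧
      ∀ z ∈ A, ∀ w ∈ A, G.Adj z w → s(z, w) ∈ p.edges := by
  induction hn : A.ncard using Nat.strong_induction_on generalizing A b with
  | _ n ih =>
  by_cases hab : b = a
  · subst hab
    obtain rfl := hmin {b} (by simpa using hb) (connSet_singleton G b) rfl rfl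
    refine ⟨Walk.nil, Walk.IsPath.nil, by simp, ?_⟩
    rintro z rfl w rfl h
    exact absurd h (G.irrefl)
  obtain ⟨x, hx, hxa, hc⟩ := hA.exists_ne_diff ha hb hab
  obtain rfl : x = b := by
    by_contra hxb
    have := hmin _ Set.sdiff_subset hc ⟨ha, Ne.symm hxa⟩ ⟨hb, Ne.symm hxb⟩
    exact (this.ge hx).2 rfl
  have haA : a ∈ A \ {x} := ⟨ha, Ne.symm hab⟩
  have hext : ∀ W ⊆ A \ {x}, ConnSet G W → a ∈ W → (∃ d ∈ W, G.Adj d x) → W = A \ {x} := by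
    rintro W hW hWc haW ⟨d, hd, hdx⟩
    have := hmin (W ∪ {x}) (by grind) (hWc.union (connSet_singleton G x) ⟨d, hd, x, rfl, hdx⟩)
      (Or.inl haW) (Or.inr rfl)
    grind
  obtain ⟨c, hcA, hcx⟩ : ∃ c ∈ A \ {x}, G.Adj c x := by
    simpa only [Touch, Set.mem_singleton_iff, exists_eq_left] using
      hA.touch_of_union_eq (S := A \ {x}) (T := {x}) (by grind) Set.disjoint_sdiff_left
        ⟨a, haA⟩ ⟨x, rfl⟩
  have huniq : ∀ c' ∈ A, G.Adj c' x → c' = c := by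
    intro c' hc'A hc'x
    by_contra hne
    have hc' : c' ∈ A \ {x} := ⟨hc'A, hc'x.ne⟩
    obtain ⟨e, heA, hea⟩ : ∃ e ∈ A \ {x}, e ≠ a := by
      by_cases h : c = a
      · exact ⟨c', hc', h ▸ hne⟩
      · exact ⟨c, hcA, h⟩
    obtain ⟨z, hz, hza, hzc⟩ := hc.exists_ne_diff haA heA hea
    refine (hext _ Set.sdiff_subset hzc ⟨haA, hza.symm⟩ ?_ |>.ge hz).2 rfl
    by_cases h : c = z
    · exact ⟨c', ⟨hc', h ▸ hne⟩, hc'x⟩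
    · exact ⟨c, ⟨hcA, h⟩, hcx⟩
  obtain ⟨p, hp, hs, he⟩ := ih _ (hn ▸ Set.ncard_sdiff_singleton_lt_of_mem hx) hc haA hcA
    (fun W hW hWc haW hcW ↦ hext W hW hWc haW ⟨c, hcW, hcx⟩) rfl
  refine ⟨p.concat hcx, hp.concat (by simp [hs]) hcx, fun z ↦ ?_, fun z hz w hw hzw ↦ ?_⟩
  · rw [Walk.support_concat]
    simp only [List.mem_append, List.mem_singleton, hs]
    grind
  · rw [Walk.edges_concat]
    simp only [List.concat_eq_append, List.mem_append, List.mem_singleton]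
    by_cases hzx : z = x
    · subst hzx
      rw [huniq w hw hzw.symm]
      exact Or.inr Sym2.eq_swap
    · by_cases hwx : w = x
      · subst hwx
        rw [huniq z hz hzw]
        exact Or.inr rfl
      · exact Or.inl (he z ⟨hz, hzx⟩ w ⟨hw, hwx⟩ hzw)

theorem K4Spanning.twoTrianglesThreePaths [Finite α] (hsp : K4Spanning G) {X Y : Fin 3 → Set α}
    (hM : PrismModel G X Y) : TwoTrianglesThreePaths G := by
  obtain ⟨x, Y, hM⟩ := hsp.exists_prismModel_singleton hM
  choose y hyY hy _ using hsp.prism_apex hM.swap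
  have hx : ∀ i j, i ≠ j → G.Adj (x i) (x j) := fun i j hij ↦ by
    simpa [Touch] using hM.touchX i j hij
  have hYY : ∀ i j, i ≠ j → ∀ z ∈ Y i, ∀ w ∈ Y j, G.Adj z w → z = y i ∧ w = y j := by
    intro i j hij z hz w hw hzw
    by_contra! hne
    by_cases h : z = y i
    · exact hy j i hij ⟨w, ⟨hw, hne h⟩, z, hz, hzw.symm⟩
    · exact hy i j hij.symm ⟨z, ⟨hz, h⟩, w, hw, hzw⟩
  have hyy : ∀ i j, i ≠ j → G.Adj (y i) (y j) := by
    intro i j hij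
    obtain ⟨z, hz, w, hw, hzw⟩ := hM.touchY i j hij
    obtain ⟨rfl, rfl⟩ := hYY i j hij z hz w hw hzw
    exact hzw
  have hUc : ∀ i, ConnSet G ({x i} ∪ Y i) := fun i ↦ (hM.connX i).union (hM.connY i) (hM.rung i)
  have hpath : ∀ i, ∃ p : G.Walk (x i) (y i), p.IsPath ∧ (∀ z, z ∈ p.support ↔ z ∈ {x i} ∪ Y i) ∧
      ∀ z ∈ {x i} ∪ Y i, ∀ w ∈ {x i} ∪ Y i, G.Adj z w → s(z, w) ∈ p.edges := by
    intro i
    refine (hUc i).exists_inducedPath (Or.inl rfl) (Or.inr (hyY i)) fun W hWs hW hxW hyW ↦ ?_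
    obtain ⟨j, k, hij, -⟩ := exists_pair i
    exact hsp.prism_part_eq hM hij hW hWs ⟨x i, hxW, x j, rfl, hx i j hij⟩
      fun l hl ↦ ⟨y i, hyW, y l, hyY l, hyy i l hl.symm⟩
  choose P hP hs he using hpath
  have hdisj : ∀ i j, i ≠ j → ∀ z, z ∈ (P i).support → z ∉ (P j).support := by
    intro i j hij z hz hz'
    rw [hs] at hz hz'
    exact Set.disjoint_left.1 (hM.disjoint_rung hij) hz hz'
  have hcover : ∀ z, ∃ i, z ∈ (P i).support := by
    intro z
    simp only [hs]
    have t : ∀ l ≠ 0, Touch G ({x 0} ∪ Y 0) (Y l) := fun l hl ↦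
      touch_union_left.2 (Or.inr (hM.touchY 0 l hl.symm))
    obtain h | ⟨l, -, h⟩ := hsp.prism_part hM (show (0 : Fin 3) ≠ 1 by decide)
      (show (0 : Fin 3) ≠ 2 by decide) (by decide) (hUc 0) subset_rfl
      (touch_union_left.2 (Or.inl (hM.touchX 0 2 (by decide)))) (t 1 (by decide))
      (t 2 (by decide)) z
    · exact ⟨0, h⟩
    · exact ⟨l, h⟩
  refine ⟨x, y, hx, hyy, ?_, P, hP, hdisj, ?_, hcover, ?_⟩
  · rintro i j h
    exact Set.disjoint_left.1 (hM.disjXY i j) rfl (h ▸ hyY j)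
  · intro i j z hz hzj
    by_cases hij : i = j
    · rwa [hij]
    · refine absurd ?_ (hdisj i j hij z hz)
      rcases hzj with rfl | rfl
      · exact Walk.start_mem_support _
      · exact Walk.end_mem_support _
  · intro z w hzw
    obtain ⟨i, hi⟩ := hcover z
    obtain ⟨j, hj⟩ := hcover w
    rw [hs] at hi hj
    by_cases hij : i = j
    · subst hij
      exact Or.inr ⟨i, he i z hi w hj hzw⟩
    · refine Or.inl ⟨i, j, hij, ?_⟩
      rcases hi with hi | hi <;> rcases hj with hj | hj
      · exact Or.inl ⟨hi, hj⟩
      · exact absurd ⟨z, hi, w, hj, hzw⟩ (hsp.prism_not_touch hM hij)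
      · exact absurd ⟨w, hj, z, hi, hzw.symm⟩ (hsp.prism_not_touch hM (Ne.symm hij))
      · exact Or.inr (hYY i j hij z hi w hj hzw)

end

/-- Every connected `K₄`-minimal graph is a subdivision of `K₄`, or a wheel, or
consists of two disjoint triangles joined by three disjoint paths, or is isomorphic
to `K_{3,3}`, or has at most five vertices of degree at least 3. -/
theorem k4_minimal_classification (G : SimpleGraph α) [Fintype α]
    (hconn : G.Connected) (hmin : MinorMinimal G (⊤ : SimpleGraph (Fin 4))) :
    IsSubdivision G (⊤ : SimpleGraph (Fin 4)) ∨
    IsWheel G ∨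
    TwoTrianglesThreePaths G ∨
    Nonempty (G ≃g completeBipartiteGraph (Fin 3) (Fin 3)) ∨
    {u : α | 3 ≤ (G.neighborSet u).ncard}.ncard ≤ 5 := by
  have hsp := hmin.k4Spanning
  obtain ⟨A, B, C, D, hK⟩ := hmin.exists_k4Model
  by_cases hw : ∀ H A B C D, ¬ W4Model G H A B C D
  · exact Or.inr (Or.inr (Or.inr (Or.inr
      ((hsp.ncard_branch_le hw hK).trans (by norm_num)))))
  by_cases hpr : ∀ X Y, ¬ PrismModel G X Y
  · by_cases hk : ∀ X Y, ¬ K33Model G X Y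
    · push Not at hw
      obtain ⟨_, _, _, _, _, hM⟩ := hw
      exact Or.inr (Or.inl (hsp.isWheel hpr hk hM))
    · push Not at hk
      obtain ⟨_, _, hM⟩ := hk
      exact Or.inr (Or.inr (Or.inr (Or.inl (hsp.iso_completeBipartiteGraph hM))))
  · push Not at hpr
    obtain ⟨_, _, hM⟩ := hpr
    exact Or.inr (Or.inr (Or.inl (hsp.twoTrianglesThreePaths hM)))
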